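/- arXiv:2106.05949 — 2 statements merged into one kernel-verified Lean document; each statement's English description precedes it below -/
import Mathlib

section
/- For n ≥ 4, the number of elements x ∈ L_n with μ_{L_n}(x, [n]) ≠ 0 is exactly 2^{ω(n-1)+2}, where ω(m) is the number of distinct prime divisors of m. -/
open scoped Classical

/-- An arithmetic progression of integers: a finite set of the form
`{a, a+r, ..., a+(k-1)r}` with `a : ℤ`, `r ≥ 1` and `k ≥ 0` (so the empty set and all
singletons are arithmetic progressions). -/
def IsAP (s : Finset ℤ) : Prop :=
  ∃ (a r : ℤ) (k : ℕ), 1 ≤ r ∧ s = (Finset.range k).image (fun i => a + (i : ℤ) * r)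

/-- The number `p_{nk}` of arithmetic progressions of cardinality `k` contained in `{1,…,n}`. -/
noncomputable def numAP (n k : ℕ) : ℕ :=
  ((Finset.Icc (1:ℤ) (n:ℤ)).powerset.filter (fun s => IsAP s ∧ s.card = k)).card

/-- The Möbius function of the poset of arithmetic progressions ordered by inclusion,
defined by `μ(x,x) = 1` and `μ(x,y) = -∑_{x ≤ z < y} μ(x,z)`, where `z` ranges over
arithmetic progressions with `x ⊆ z ⊂ y`.  (For `x ⊆ y ⊆ {1,…,n}`, all arithmetic
progressions `z` with `x ⊆ z ⊂ y` automatically lie in `L_n`, so this is the Möbius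
function of any interval `[x, y]` of the lattice `L_n`.) -/
noncomputable def apMu (x y : Finset ℤ) : ℤ :=
  if x = y then 1
  else - ∑ z ∈ (y.powerset.filter (fun z => IsAP z ∧ x ⊆ z ∧ z ≠ y)).attach, apMu x z.1
termination_by y.card
decreasing_by
  rename_i z
  have hz := z.2
  rw [Finset.mem_filter, Finset.mem_powerset] at hz
  exact Finset.card_lt_card (lt_of_le_of_ne hz.1 hz.2.2.2)

/-- The join of `a` and `b` in the lattice of arithmetic progressions contained in `t`:
the intersection of all arithmetic progressions contained in `t` that contain `a ∪ b`,
i.e. the smallest such progression. -/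
noncomputable def apJoin (t a b : Finset ℤ) : Finset ℤ :=
  t.filter (fun v => ∀ z : Finset ℤ, IsAP z → z ⊆ t → a ∪ b ⊆ z → v ∈ z)

/-- The meet (intersection) of a finite family `S` of subsets of the top element `t`;
the meet of the empty family is `t` itself. -/
def apMeet (t : Finset ℤ) (S : Finset (Finset ℤ)) : Finset ℤ :=
  S.fold (· ⊓ ·) t id

/-- `x` is a coatom of the lattice `L_n` of arithmetic progressions contained in
`{1,…,n}`: an element distinct from the maximum `{1,…,n}` with no element strictly
between it and the maximum. -/
def IsCoatomIn (n : ℕ) (x : Finset ℤ) : Prop :=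
  IsAP x ∧ x ⊆ Finset.Icc (1:ℤ) (n:ℤ) ∧ x ≠ Finset.Icc (1:ℤ) (n:ℤ) ∧
    ∀ y : Finset ℤ, IsAP y → y ⊆ Finset.Icc (1:ℤ) (n:ℤ) → x ⊂ y → y = Finset.Icc (1:ℤ) (n:ℤ)

/-- `y` is covered by `top` in the poset of arithmetic progressions: `y < top` and there
is no arithmetic progression strictly between them. -/
def CoveredIn (top y : Finset ℤ) : Prop :=
  IsAP y ∧ y ⊂ top ∧ ¬ ∃ z : Finset ℤ, IsAP z ∧ y ⊂ z ∧ z ⊂ top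

/-- `c` is a maximal chain in the lattice `L_n` of arithmetic progressions contained
in `{1,…,n}`: a chain (under inclusion) of elements of `L_n` to which no further
element of `L_n` can be added. -/
def IsMaxChainIn (n : ℕ) (c : Finset (Finset ℤ)) : Prop :=
  (∀ s ∈ c, IsAP s ∧ s ⊆ Finset.Icc (1:ℤ) (n:ℤ)) ∧
  IsChain (· ⊆ ·) (↑c : Set (Finset ℤ)) ∧
  ∀ z : Finset ℤ, IsAP z → z ⊆ Finset.Icc (1:ℤ) (n:ℤ) →
    IsChain (· ⊆ ·) (insert z (↑c : Set (Finset ℤ))) → z ∈ c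

/-- The number `b_{nk}` of chains of length `k` (i.e. totally ordered subsets with `k+1`
elements) in `L_n` that contain both `∅` and `{1,…,n}`. -/
noncomputable def numChains (n k : ℕ) : ℕ :=
  (((Finset.Icc (1:ℤ) (n:ℤ)).powerset.filter IsAP).powerset.filter
    (fun c : Finset (Finset ℤ) => c.card = k + 1 ∧ ∅ ∈ c ∧ Finset.Icc (1:ℤ) (n:ℤ) ∈ c ∧
      IsChain (· ⊆ ·) (↑c : Set (Finset ℤ)))).card

/-- The Möbius function sums to a delta function over each principal ideal. -/
theorem sum_apMu (x y : Finset ℤ) (hy : IsAP y) :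
    ∑ z ∈ y.powerset.filter (fun z => IsAP z ∧ x ⊆ z), apMu x z = if x = y then 1 else 0 := by
  by_cases hxy : x ⊆ y
  · have hmem : y ∈ y.powerset.filter (fun z => IsAP z ∧ x ⊆ z) := by simp [hy, hxy]
    have herase : (y.powerset.filter (fun z => IsAP z ∧ x ⊆ z)).erase y
        = y.powerset.filter (fun z => IsAP z ∧ x ⊆ z ∧ z ≠ y) := by
      ext z
      simp only [Finset.mem_erase, Finset.mem_filter]
      tauto
    rw [← Finset.add_sum_erase _ _ hmem, herase, apMu]
    split_ifs with h
    · subst h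
      rw [Finset.sum_eq_zero, add_zero]
      intro z hz
      simp only [Finset.mem_filter, Finset.mem_powerset] at hz
      exact absurd (hz.1.antisymm hz.2.2.1) hz.2.2.2
    · rw [Finset.sum_attach _ (fun z => apMu x z), neg_add_cancel]
  · rw [if_neg (fun h => hxy h.subset)]
    apply Finset.sum_eq_zero
    intro z hz
    simp only [Finset.mem_filter, Finset.mem_powerset] at hz
    exact absurd (hz.2.2.trans hz.1) hxy

/-- A crosscut formula: if a family of predicates `P i`, `i ∈ T`, has the property that every
proper progression in `y` satisfies one of them, then the Möbius function of `y` is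
an alternating sum over the subsets of `T`. -/
theorem apMu_eq_sum_powerset {ι : Type*} (T : Finset ι) (P : ι → ℤ → Prop) (x y : Finset ℤ)
    (hxy : x ⊆ y) (hy : IsAP y)
    (hmeet : ∀ S ⊆ T, IsAP (y.filter (fun v => ∀ i ∈ S, P i v)))
    (htop : ∀ i ∈ T, ∃ v ∈ y, ¬ P i v)
    (hcover : ∀ w, IsAP w → w ⊆ y → w ≠ y → ∃ i ∈ T, ∀ v ∈ w, P i v) :
    apMu x y = ∑ S ∈ T.powerset,
      (-1) ^ S.card * (if x = y.filter (fun v => ∀ i ∈ S, P i v) then (1 : ℤ) else 0) := by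
  set U := y.powerset.filter (fun z => IsAP z ∧ x ⊆ z) with hU
  have hsum : ∀ S ∈ T.powerset,
      (if x = y.filter (fun v => ∀ i ∈ S, P i v) then (1 : ℤ) else 0)
        = ∑ w ∈ U, if S ⊆ T.filter (fun i => ∀ v ∈ w, P i v) then apMu x w else 0 := by
    intro S hS
    rw [Finset.mem_powerset] at hS
    rw [← sum_apMu x _ (hmeet S hS), ← Finset.sum_filter]
    congr 1
    ext w
    simp only [hU, Finset.mem_filter, Finset.mem_powerset, Finset.subset_iff]
    constructor
    · rintro ⟨h1, h2⟩
      exact ⟨⟨fun v hv => (h1 hv).1, h2⟩, fun i hi => ⟨hS hi, fun v hv => (h1 hv).2 i hi⟩⟩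
    · rintro ⟨⟨h1, h2⟩, h3⟩
      exact ⟨fun v hv => ⟨h1 hv, fun i hi => (h3 hi).2 v hv⟩, h2⟩
  rw [Finset.sum_congr rfl (fun S hS => by rw [hsum S hS])]
  simp_rw [Finset.mul_sum]
  rw [Finset.sum_comm]
  have hinner : ∀ w ∈ U, (∑ S ∈ T.powerset, (-1 : ℤ) ^ S.card *
      (if S ⊆ T.filter (fun i => ∀ v ∈ w, P i v) then apMu x w else 0))
      = if w = y then apMu x w else 0 := by
    intro w hw
    simp only [hU, Finset.mem_filter, Finset.mem_powerset] at hw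
    simp_rw [mul_ite, mul_zero]
    rw [← Finset.sum_filter]
    have hpow : T.powerset.filter (fun S => S ⊆ T.filter (fun i => ∀ v ∈ w, P i v))
        = (T.filter (fun i => ∀ v ∈ w, P i v)).powerset := by
      ext S
      simp only [Finset.mem_filter, Finset.mem_powerset, and_iff_right_iff_imp]
      exact fun h => h.trans (Finset.filter_subset _ _)
    rw [hpow, ← Finset.sum_mul, Finset.sum_powerset_neg_one_pow_card]
    have hiff : T.filter (fun i => ∀ v ∈ w, P i v) = ∅ ↔ w = y := by
      rw [Finset.filter_eq_empty_iff]
      constructor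
      · intro h
        by_contra hne
        obtain ⟨i, hi, hv⟩ := hcover w hw.2.1 hw.1 hne
        exact h hi hv
      · rintro rfl i hi h
        obtain ⟨v, hv, hP⟩ := htop i hi
        exact hP (h v hv)
    simp only [hiff, ite_mul, one_mul, zero_mul]
  rw [Finset.sum_congr rfl hinner, Finset.sum_ite_eq' U y, if_pos]
  simp [hU, hy, hxy]

theorem isAP_iff (s : Finset ℤ) : IsAP s ↔
    ∃ (a r : ℤ) (k : ℕ), 1 ≤ r ∧ ∀ v, v ∈ s ↔ ∃ i : ℕ, i < k ∧ a + (i : ℤ) * r = v := by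
  simp only [IsAP, Finset.ext_iff]
  simp

theorem isAP_filter_dvd (a b : ℤ) (d : ℤ) (hd : 1 ≤ d) :
    IsAP ((Finset.Icc a b).filter (fun v => d ∣ v - 1)) := by
  have hmod0 := Int.emod_nonneg (1 - a) (b := d) (by omega)
  have hmod1 := Int.emod_lt_of_pos (1 - a) (b := d) (by omega)
  have hdm := Int.mul_ediv_add_emod (1 - a) d
  set s := (1 - a) % d
  set q := (1 - a) / d
  refine (isAP_iff _).2 ⟨a + s, d, ((b - (a + s)) / d + 1).toNat, hd, fun v => ?_⟩
  simp only [Finset.mem_filter, Finset.mem_Icc]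
  constructor
  · rintro ⟨⟨hav, hvb⟩, c, hc⟩
    have hj : 0 ≤ c + q := by
      by_contra! h
      nlinarith
    refine ⟨(c + q).toNat, ?_, ?_⟩
    · have : c + q ≤ (b - (a + s)) / d := by
        rw [Int.le_ediv_iff_mul_le (by omega)]
        linarith
      omega
    · rw [Int.toNat_of_nonneg hj]
      linarith
  · rintro ⟨i, hi, rfl⟩
    have hi' : (i : ℤ) ≤ (b - (a + s)) / d := by omega
    rw [Int.le_ediv_iff_mul_le (by omega)] at hi'
    have : (0 : ℤ) ≤ i * d := by positivity
    exact ⟨⟨by linarith, by linarith⟩, i - q, by linarith⟩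

theorem isAP_Icc (a b : ℤ) : IsAP (Finset.Icc a b) := by
  simpa using isAP_filter_dvd a b 1 le_rfl

/-- Membership predicates of the coatoms of `L_n`: the indices `0` and `1` stand for `[2, n]` and
`[1, n - 1]`, any other index `p` for the progression of difference `p` through `1`. -/
def coatomPred (n : ℕ) : ℕ → ℤ → Prop
  | 0, v => v ≠ 1
  | 1, v => v ≠ n
  | p, v => (p : ℤ) ∣ v - 1

theorem coatomPred_of_two_le (n : ℕ) {p : ℕ} (hp : 2 ≤ p) (v : ℤ) :
    coatomPred n p v ↔ (p : ℤ) ∣ v - 1 := by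
  obtain ⟨k, rfl⟩ := Nat.exists_eq_add_of_le' hp
  rfl

/-- The indices of the coatoms of `L_n`. -/
def coatomIndices (n : ℕ) : Finset ℕ := insert 0 (insert 1 (n - 1).primeFactors)

theorem card_coatomIndices (n : ℕ) :
    (coatomIndices n).card = (n - 1).primeFactors.card + 2 := by
  rw [coatomIndices, Finset.card_insert_of_notMem, Finset.card_insert_of_notMem]
  · simp [Nat.not_prime_one]
  · simp

theorem mem_coatomIndices {n i : ℕ} :
    i ∈ coatomIndices n ↔ i = 0 ∨ i = 1 ∨ i ∈ (n - 1).primeFactors := by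
  simp [coatomIndices]

theorem forall_coatomPred_iff {n : ℕ} {S : Finset ℕ} (hS : S ⊆ coatomIndices n) (v : ℤ) :
    (∀ i ∈ S, coatomPred n i v) ↔ (0 ∈ S → v ≠ 1) ∧ (1 ∈ S → v ≠ n) ∧
      ((∏ p ∈ S.filter Nat.Prime, p : ℕ) : ℤ) ∣ v - 1 := by
  constructor
  · intro h
    refine ⟨fun h0 => h 0 h0, fun h1 => h 1 h1, ?_⟩
    rw [Int.natCast_dvd]
    refine Finset.prod_primes_dvd _ (fun p hp => (Finset.mem_filter.1 hp).2.prime) fun p hp => ?_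
    rw [Finset.mem_filter] at hp
    rw [← Int.natCast_dvd, ← coatomPred_of_two_le n hp.2.two_le]
    exact h p hp.1
  · rintro ⟨h0, h1, hd⟩ i hi
    rcases mem_coatomIndices.1 (hS hi) with rfl | rfl | hp
    · exact h0 hi
    · exact h1 hi
    · have hp' := Nat.prime_of_mem_primeFactors hp
      rw [coatomPred_of_two_le n hp'.two_le]
      refine dvd_trans ?_ hd
      exact_mod_cast Finset.dvd_prod_of_mem (fun p => p) (Finset.mem_filter.2 ⟨hi, hp'⟩)

theorem isAP_filter_coatomPred {n : ℕ} {S : Finset ℕ} (hS : S ⊆ coatomIndices n) :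
    IsAP ((Finset.Icc (1 : ℤ) n).filter (fun v => ∀ i ∈ S, coatomPred n i v)) := by
  have hpos : 0 < ∏ p ∈ S.filter Nat.Prime, p :=
    Finset.prod_pos fun p hp => (Finset.mem_filter.1 hp).2.pos
  convert isAP_filter_dvd (if 0 ∈ S then 2 else 1) (if 1 ∈ S then n - 1 else n)
    (∏ p ∈ S.filter Nat.Prime, p : ℕ) (by omega) using 1
  ext v
  simp only [Finset.mem_filter, Finset.mem_Icc, forall_coatomPred_iff hS, ← and_assoc]
  refine and_congr_left fun _ => ?_
  split_ifs with h0 h1 h1 <;> simp only [h0, h1, true_imp_iff, false_imp_iff, and_true] <;> omega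

theorem exists_not_coatomPred {n : ℕ} (hn : 2 ≤ n) {S : Finset ℕ} (hS : S ⊆ coatomIndices n)
    {i : ℕ} (hi : i ∈ coatomIndices n) (hiS : i ∉ S) :
    ∃ v ∈ (Finset.Icc (1 : ℤ) n).filter (fun v => ∀ i ∈ S, coatomPred n i v),
      ¬ coatomPred n i v := by
  have hsub : S.filter Nat.Prime ⊆ (n - 1).primeFactors := by
    intro p hp
    rw [Finset.mem_filter] at hp
    rcases mem_coatomIndices.1 (hS hp.1) with rfl | rfl | h
    · exact absurd hp.2 Nat.not_prime_zero
    · exact absurd hp.2 Nat.not_prime_one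
    · exact h
  have hdvd : ∏ p ∈ S.filter Nat.Prime, p ∣ n - 1 :=
    (Finset.prod_dvd_prod_of_subset _ _ _ hsub).trans (Nat.prod_primeFactors_dvd _)
  have hpos : 0 < ∏ p ∈ S.filter Nat.Prime, p :=
    Finset.prod_pos fun p hp => (Finset.mem_filter.1 hp).2.pos
  simp only [Finset.mem_filter, forall_coatomPred_iff hS, Finset.mem_Icc]
  rcases mem_coatomIndices.1 hi with rfl | rfl | hp
  · exact ⟨1, ⟨by omega, fun h => absurd h hiS, by omega, by simp⟩, fun h => h rfl⟩
  · refine ⟨n, ⟨by omega, by omega, fun h => absurd h hiS, ?_⟩, fun h => h rfl⟩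
    have := Int.natCast_dvd_natCast.2 hdvd
    rwa [Nat.cast_sub (by omega), Nat.cast_one] at this
  · have hp' := Nat.prime_of_mem_primeFactors hp
    have hnd : ¬ i ∣ ∏ p ∈ S.filter Nat.Prime, p := by
      intro h
      obtain ⟨q, hq, hiq⟩ := (hp'.prime.dvd_finsetProd_iff _).1 h
      rw [Finset.mem_filter] at hq
      rw [(Nat.prime_dvd_prime_iff_eq hp' hq.2).1 hiq] at hiS
      exact hiS hq.1
    have hle := Nat.le_of_dvd (by omega) hdvd
    have hne : ∏ p ∈ S.filter Nat.Prime, p ≠ n - 1 := fun h =>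
      hnd (h ▸ Nat.dvd_of_mem_primeFactors hp)
    refine ⟨1 + (∏ p ∈ S.filter Nat.Prime, p : ℕ),
      ⟨by omega, by omega, by omega, by simp⟩, ?_⟩
    rw [coatomPred_of_two_le n hp'.two_le, add_sub_cancel_left]
    exact_mod_cast hnd

theorem exists_forall_coatomPred {n : ℕ} (hn : 2 ≤ n) {w : Finset ℤ} (hw : IsAP w)
    (hsub : w ⊆ Finset.Icc (1 : ℤ) n) (hne : w ≠ Finset.Icc (1 : ℤ) n) :
    ∃ i ∈ coatomIndices n, ∀ v ∈ w, coatomPred n i v := by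
  by_cases h1 : (1 : ℤ) ∈ w
  swap
  · exact ⟨0, by simp [coatomIndices], fun v hv h => h1 (h ▸ hv)⟩
  by_cases h2 : (n : ℤ) ∈ w
  swap
  · exact ⟨1, by simp [coatomIndices], fun v hv h => h2 (h ▸ hv)⟩
  obtain ⟨a, r, k, hr, hmem⟩ := (isAP_iff w).1 hw
  obtain ⟨i, hi, hi1⟩ := (hmem _).1 h1
  obtain ⟨j, hj, hjn⟩ := (hmem _).1 h2
  have hr1 : r ≠ 1 := by
    rintro rfl
    refine hne (hsub.antisymm fun v hv => ?_)
    rw [Finset.mem_Icc] at hv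
    exact (hmem v).2 ⟨(v - a).toNat, by omega, by omega⟩
  have hdvd : ∀ m : ℕ, r ∣ a + m * r - 1 := fun m => ⟨m - i, by linarith⟩
  have hp : (r.natAbs.minFac).Prime := Nat.minFac_prime (by omega)
  have hpr : (r.natAbs.minFac : ℤ) ∣ r := Int.natCast_dvd.2 (Nat.minFac_dvd _)
  refine ⟨r.natAbs.minFac, mem_coatomIndices.2 (.inr (.inr ?_)), fun v hv => ?_⟩
  · rw [Nat.mem_primeFactors]
    refine ⟨hp, ?_, by omega⟩
    have := hpr.trans (hdvd j)
    rw [hjn] at this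
    rw [← Int.natCast_dvd_natCast, Nat.cast_sub (by omega), Nat.cast_one]
    exact this
  · obtain ⟨m, -, rfl⟩ := (hmem v).1 hv
    rw [coatomPred_of_two_le n hp.two_le]
    exact hpr.trans (hdvd m)

/-- Distinct sets of coatoms of `L_n` have distinct meets. -/
theorem injOn_filter_coatomPred {n : ℕ} (hn : 2 ≤ n) :
    Set.InjOn (fun S : Finset ℕ =>
      (Finset.Icc (1 : ℤ) n).filter (fun v => ∀ i ∈ S, coatomPred n i v))
      ((coatomIndices n).powerset : Set (Finset ℕ)) := by
  have key : ∀ S ⊆ coatomIndices n, ∀ S' ⊆ coatomIndices n,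
      (Finset.Icc (1 : ℤ) n).filter (fun v => ∀ i ∈ S, coatomPred n i v)
        = (Finset.Icc (1 : ℤ) n).filter (fun v => ∀ i ∈ S', coatomPred n i v) → S ⊆ S' := by
    intro S hS S' hS' h i hi
    by_contra hiS'
    obtain ⟨v, hv, hvi⟩ := exists_not_coatomPred hn hS' (hS hi) hiS'
    rw [← h, Finset.mem_filter] at hv
    exact hvi (hv.2 i hi)
  intro S hS S' hS' h
  rw [Finset.mem_coe, Finset.mem_powerset] at hS hS'
  exact (key S hS S' hS' h).antisymm (key S' hS' S hS h.symm)

/-- For `n ≥ 4`, the number of elements `x ∈ L_n` with `μ_{L_n}(x, [n]) ≠ 0` is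
exactly `2^{ω(n-1)+2}`. -/
theorem card_nonzero_mobius (n : ℕ) (hn : 4 ≤ n) :
    ((Finset.Icc (1:ℤ) (n:ℤ)).powerset.filter
        (fun x => IsAP x ∧ apMu x (Finset.Icc (1:ℤ) (n:ℤ)) ≠ 0)).card
      = 2 ^ ((n - 1).primeFactors.card + 2) := by
  have hn2 : 2 ≤ n := by omega
  have hinj := injOn_filter_coatomPred hn2
  have hmu : ∀ x ⊆ Finset.Icc (1 : ℤ) n, apMu x (Finset.Icc (1 : ℤ) n) = _ := fun x hx =>
    apMu_eq_sum_powerset (coatomIndices n) (coatomPred n) x (Finset.Icc (1 : ℤ) n) hx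
      (isAP_Icc 1 n) (fun S hS => isAP_filter_coatomPred hS)
      (fun i hi => by
        simpa using exists_not_coatomPred hn2 (Finset.empty_subset _) hi (Finset.notMem_empty i))
      (fun w hw hsub hne => exists_forall_coatomPred hn2 hw hsub hne)
  rw [← card_coatomIndices, ← Finset.card_powerset, ← Finset.card_image_of_injOn hinj]
  congr 1
  ext x
  simp only [Finset.mem_filter, Finset.mem_powerset, Finset.mem_image]
  constructor
  · rintro ⟨hx, -, hne⟩
    rw [hmu x hx] at hne
    obtain ⟨S, hS, hSne⟩ := Finset.exists_ne_zero_of_sum_ne_zero hne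
    refine ⟨S, Finset.mem_powerset.1 hS, ?_⟩
    by_contra h
    exact hSne (by rw [if_neg (Ne.symm h), mul_zero])
  · rintro ⟨S, hS, rfl⟩
    refine ⟨Finset.filter_subset _ _, isAP_filter_coatomPred hS, ?_⟩
    rw [hmu _ (Finset.filter_subset _ _), Finset.sum_eq_single_of_mem S (Finset.mem_powerset.2 hS)]
    · simp
    · intro S' hS' hne
      rw [if_neg, mul_zero]
      exact fun h => hne (hinj hS' (Finset.mem_coe.2 (Finset.mem_powerset.2 hS)) h.symm)
end

section
/- For n ≥ 2, the lattice L_n is complemented (every x ∈ L_n has some y ∈ L_n with x ∨ y = [n] and x ∧ y = ∅) if and only if n-1 is squarefree. Moreover, if n-1 is not squarefree, then there exists x ∈ L_n with x ∉ {∅, [n]} whose only upper semicomplement is [n]: the only y ∈ L_n with x ∨ y = [n] is y = [n]. -/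
open scoped Classical

theorem isAP_iff_forall_mem_iff {s : Finset ℤ} :
    IsAP s ↔ ∃ (a r : ℤ) (k : ℕ), 1 ≤ r ∧ ∀ v, v ∈ s ↔ ∃ i : ℕ, i < k ∧ a + i * r = v := by
  unfold IsAP
  refine exists_congr fun a => exists_congr fun r => exists_congr fun k =>
    and_congr_right fun _ => ?_
  rw [Finset.ext_iff]
  refine forall_congr' fun v => ?_
  simp

theorem isAP_filter_dvd_sub (a b : ℤ) {d : ℤ} (hd : 1 ≤ d) :
    IsAP ((Finset.Icc a b).filter (fun v => d ∣ v - a)) := by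
  refine isAP_iff_forall_mem_iff.2 ⟨a, d, ((b - a) / d + 1).toNat, hd, fun v => ?_⟩
  rw [Finset.mem_filter, Finset.mem_Icc]
  constructor
  · rintro ⟨⟨hav, hvb⟩, c, hc⟩
    have hc0 : 0 ≤ c := by nlinarith
    have hcb : c ≤ (b - a) / d := by
      rw [Int.le_ediv_iff_mul_le (by omega)]
      nlinarith
    refine ⟨c.toNat, by omega, ?_⟩
    rw [Int.toNat_of_nonneg hc0]
    linarith
  · rintro ⟨i, hi, rfl⟩
    have hib : (i : ℤ) ≤ (b - a) / d := by omega
    rw [Int.le_ediv_iff_mul_le (by omega)] at hib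
    have h0 : 0 ≤ (i : ℤ) * d := by positivity
    exact ⟨⟨by linarith, by linarith⟩, i, by ring⟩

theorem isAP_singleton (a : ℤ) : IsAP {a} := by
  simpa using isAP_Icc a a

/-- Between two of its members, an arithmetic progression is a residue class. -/
theorem IsAP.exists_mem_iff_dvd_sub {z : Finset ℤ} (hz : IsAP z) {a b : ℤ}
    (ha : a ∈ z) (hb : b ∈ z) :
    ∃ r : ℤ, 1 ≤ r ∧ ∀ v ∈ Finset.Icc a b, (v ∈ z ↔ r ∣ v - a) := by
  obtain ⟨c, r, k, hr, hz⟩ := isAP_iff_forall_mem_iff.1 hz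
  simp only [hz] at ha hb ⊢
  obtain ⟨i, hi, rfl⟩ := ha
  obtain ⟨j, hj, rfl⟩ := hb
  refine ⟨r, hr, fun v hv => ⟨?_, ?_⟩⟩
  · rintro ⟨l, hl, rfl⟩
    exact ⟨l - i, by ring⟩
  · rintro ⟨e, he⟩
    rw [Finset.mem_Icc] at hv
    have he0 : 0 ≤ e := by nlinarith
    have hej : (i : ℤ) + e ≤ j := by nlinarith
    refine ⟨i + e.toNat, by omega, ?_⟩
    push_cast
    rw [Int.toNat_of_nonneg he0]
    linarith

theorem apJoin_eq_top_iff {t x y : Finset ℤ} :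
    apJoin t x y = t ↔ ∀ z : Finset ℤ, IsAP z → z ⊆ t → x ∪ y ⊆ z → t ⊆ z := by
  rw [apJoin, Finset.filter_eq_self]
  exact ⟨fun h z hz hzt hxy v hv => h v hv z hz hzt hxy,
    fun h v hv z hz hzt hxy => h z hz hzt hxy hv⟩

/-- The join of `x` and `y` is `[a, b]` as soon as `x ∪ y` contains both endpoints and the
differences to `a` of its members have no common divisor other than `1`. -/
theorem apJoin_eq_Icc {a b : ℤ} {x y : Finset ℤ}
    (ha : a ∈ x ∪ y) (hb : b ∈ x ∪ y)
    (h : ∀ r : ℤ, 1 ≤ r → (∀ v ∈ x ∪ y, r ∣ v - a) → r = 1) :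
    apJoin (Finset.Icc a b) x y = Finset.Icc a b := by
  rw [apJoin_eq_top_iff]
  intro z hz hzt hxy v hv
  obtain ⟨r, hr, hmem⟩ := hz.exists_mem_iff_dvd_sub (hxy ha) (hxy hb)
  have hr1 := h r hr fun w hw => (hmem w (hzt (hxy hw))).1 (hxy hw)
  rw [hmem v hv, hr1]
  exact one_dvd _

theorem Int.eq_one_of_dvd_of_dvd_add_one {r a : ℤ} (hr : 1 ≤ r) (h : r ∣ a) (h' : r ∣ a + 1) :
    r = 1 := by
  have := Int.le_of_dvd one_pos ((dvd_add_right h).1 h')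
  omega

/-- A progression in `[1, m + 1]` containing at least one endpoint has a complement. -/
theorem exists_complement_of_endpoint_mem {m : ℤ} (hm : 1 ≤ m) {x : Finset ℤ} (hx : IsAP x)
    (hxt : x ⊆ Finset.Icc 1 (m + 1)) (hend : 1 ∈ x ∨ m + 1 ∈ x) :
    ∃ y : Finset ℤ, IsAP y ∧ y ⊆ Finset.Icc 1 (m + 1) ∧
      apJoin (Finset.Icc 1 (m + 1)) x y = Finset.Icc 1 (m + 1) ∧ x ∩ y = ∅ := by
  by_cases h1 : (1 : ℤ) ∈ x
  · by_cases h2 : m + 1 ∈ x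
    · obtain ⟨r, hr, hmem⟩ := hx.exists_mem_iff_dvd_sub h1 h2
      have h2t : (2 : ℤ) ∈ Finset.Icc 1 (m + 1) := by rw [Finset.mem_Icc]; omega
      by_cases hx2 : (2 : ℤ) ∈ x
      · refine ⟨∅, ⟨0, 1, 0, le_rfl, by simp⟩, by simp, ?_, by simp⟩
        refine apJoin_eq_Icc (by simp [h1]) (by simp [h2]) fun s hs hdvd => ?_
        exact Int.eq_one_of_dvd_of_dvd_add_one hs (dvd_zero s)
          (by simpa using hdvd 2 (by simp [hx2]))
      · refine ⟨{2}, isAP_singleton 2, by simpa using h2t, ?_, Finset.inter_singleton_of_notMem hx2⟩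
        refine apJoin_eq_Icc (by simp [h1]) (by simp [h2]) fun s hs hdvd => ?_
        exact Int.eq_one_of_dvd_of_dvd_add_one hs (dvd_zero s)
          (by simpa using hdvd 2 (by simp))
    · by_cases h3 : m ∈ x
      · refine ⟨{m + 1}, isAP_singleton _, by simp; omega, ?_, Finset.inter_singleton_of_notMem h2⟩
        refine apJoin_eq_Icc (by simp [h1]) (by simp) fun s hs hdvd => ?_
        exact Int.eq_one_of_dvd_of_dvd_add_one hs (hdvd m (by simp [h3]))
          (by simpa using hdvd (m + 1) (by simp))
      · refine ⟨Finset.Icc m (m + 1), isAP_Icc _ _, Finset.Icc_subset_Icc hm le_rfl, ?_, ?_⟩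
        · refine apJoin_eq_Icc (by simp [h1]) (by simp) fun s hs hdvd => ?_
          exact Int.eq_one_of_dvd_of_dvd_add_one hs (hdvd m (by simp))
            (by simpa using hdvd (m + 1) (by simp))
        · rw [Finset.eq_empty_iff_forall_notMem]
          intro v hv
          rw [Finset.mem_inter, Finset.mem_Icc] at hv
          obtain rfl | rfl : v = m ∨ v = m + 1 := by omega
          exacts [h3 hv.1, h2 hv.1]
  · have h2 : m + 1 ∈ x := hend.resolve_left h1
    by_cases h3 : (2 : ℤ) ∈ x
    · refine ⟨{1}, isAP_singleton _, by simp; omega, ?_, Finset.inter_singleton_of_notMem h1⟩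
      refine apJoin_eq_Icc (by simp) (by simp [h2]) fun s hs hdvd => ?_
      exact Int.eq_one_of_dvd_of_dvd_add_one hs (dvd_zero s)
        (by simpa using hdvd 2 (by simp [h3]))
    · refine ⟨Finset.Icc 1 2, isAP_Icc _ _, Finset.Icc_subset_Icc le_rfl (by omega), ?_, ?_⟩
      · refine apJoin_eq_Icc (by simp) (by simp [h2]) fun s hs hdvd => ?_
        exact Int.eq_one_of_dvd_of_dvd_add_one hs (dvd_zero s)
          (by simpa using hdvd 2 (by simp))
      · rw [Finset.eq_empty_iff_forall_notMem]
        intro v hv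
        rw [Finset.mem_inter, Finset.mem_Icc] at hv
        obtain rfl | rfl : v = 1 ∨ v = 2 := by omega
        exacts [h1 hv.1, h3 hv.1]

theorem exists_complement_of_squarefree {m : ℤ} (hm : 1 ≤ m) (hsq : Squarefree m)
    {x : Finset ℤ} (h1 : 1 ∉ x) (h2 : m + 1 ∉ x) :
    ∃ y : Finset ℤ, IsAP y ∧ y ⊆ Finset.Icc 1 (m + 1) ∧
      apJoin (Finset.Icc 1 (m + 1)) x y = Finset.Icc 1 (m + 1) ∧ x ∩ y = ∅ := by
  set g : ℤ := gcd m (x.gcd fun v => v - 1)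
  have hgx : ∀ v ∈ x, g ∣ v - 1 := fun v hv =>
    (gcd_dvd_right _ _).trans (Finset.gcd_dvd hv)
  have hg0 : 0 ≤ g := Int.natCast_nonneg _
  obtain ⟨d, hd⟩ : g ∣ m := gcd_dvd_left _ _
  have hd1 : 1 ≤ d := by
    by_contra! hlt
    nlinarith
  have hg1 : 1 ≤ g := by
    by_contra! hlt
    nlinarith
  have hdm : d ≤ m := by nlinarith
  refine ⟨_, isAP_filter_dvd_sub 1 (m + 1) hd1, Finset.filter_subset _ _, ?_, ?_⟩
  · refine apJoin_eq_Icc ?_ ?_ fun r hr hdvd => ?_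
    · simp; omega
    · simp only [Finset.mem_union, Finset.mem_filter, Finset.mem_Icc]
      exact Or.inr ⟨by omega, g, by linarith⟩
    · have hrd : r ∣ d := by
        have := hdvd (d + 1) (by simp; omega)
        simpa using this
      have hrg : r ∣ g := dvd_gcd (hd ▸ hrd.mul_left g)
        (Finset.dvd_gcd fun v hv => hdvd v (Finset.mem_union_left _ hv))
      have hunit : IsUnit r := hsq r (hd ▸ mul_dvd_mul hrg hrd)
      rcases Int.isUnit_iff.1 hunit with h | h <;> omega
  · rw [Finset.eq_empty_iff_forall_notMem]
    intro v hv
    rw [Finset.mem_inter, Finset.mem_filter] at hv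
    have hrel : IsRelPrime g d := (squarefree_mul_iff.1 (hd ▸ hsq)).1
    obtain ⟨c, hc⟩ : m ∣ v - 1 := by
      conv_lhs => rw [hd]
      exact hrel.mul_dvd (hgx v hv.1) hv.2.2
    have hvt := Finset.mem_Icc.1 hv.2.1
    have hc0 : 0 ≤ c := by nlinarith
    have hc1 : c ≤ 1 := by nlinarith
    obtain rfl | rfl : c = 0 ∨ c = 1 := by omega
    · exact h1 (by convert hv.1 using 1; linarith)
    · exact h2 (by convert hv.1 using 1; linarith)

/-- An interior point of `[1, m + 1]` congruent to `1` modulo every prime divisor of `m` lies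
in every coatom, so it has no proper upper semicomplement. -/
theorem eq_top_of_apJoin_singleton_eq_top {m w : ℤ} (hw : 1 ≤ w) (hwm : w < m)
    (hprime : ∀ q : ℤ, Prime q → q ∣ m → q ∣ w) {y : Finset ℤ} (hy : IsAP y)
    (hyt : y ⊆ Finset.Icc 1 (m + 1))
    (hjoin : apJoin (Finset.Icc 1 (m + 1)) {w + 1} y = Finset.Icc 1 (m + 1)) :
    y = Finset.Icc 1 (m + 1) := by
  rw [apJoin_eq_top_iff] at hjoin
  have h1 : (1 : ℤ) ∈ y := by
    by_contra h1
    have := hjoin (Finset.Icc 2 (m + 1)) (isAP_Icc _ _)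
      (Finset.Icc_subset_Icc (by norm_num) le_rfl) (fun v hv => by
        rw [Finset.mem_union, Finset.mem_singleton] at hv
        rw [Finset.mem_Icc]
        rcases hv with rfl | hv
        · omega
        · have hvt := Finset.mem_Icc.1 (hyt hv)
          have : v ≠ 1 := fun h => h1 (h ▸ hv)
          omega) (Finset.mem_Icc.2 ⟨le_rfl, by omega⟩)
    simp at this
  have h2 : m + 1 ∈ y := by
    by_contra h2
    have := hjoin (Finset.Icc 1 m) (isAP_Icc _ _)
      (Finset.Icc_subset_Icc le_rfl (by omega)) (fun v hv => by
        rw [Finset.mem_union, Finset.mem_singleton] at hv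
        rw [Finset.mem_Icc]
        rcases hv with rfl | hv
        · omega
        · have hvt := Finset.mem_Icc.1 (hyt hv)
          have : v ≠ m + 1 := fun h => h2 (h ▸ hv)
          omega) (Finset.mem_Icc.2 ⟨by omega, le_rfl⟩)
    simp at this
  obtain ⟨r, hr, hmem⟩ := hy.exists_mem_iff_dvd_sub h1 h2
  obtain rfl | hr1 := eq_or_ne r 1
  · exact hyt.antisymm fun v hv => (hmem v hv).2 (one_dvd _)
  have hrm : r ∣ m := by simpa using (hmem _ (hyt h2)).1 h2
  obtain ⟨p, hp, hpr⟩ := Nat.exists_prime_and_dvd (n := r.natAbs) (by omega)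
  have hqr : (p : ℤ) ∣ r := Int.natCast_dvd.2 hpr
  have hqw := hprime p (Nat.prime_iff_prime_int.1 hp) (hqr.trans hrm)
  have hp2 := hp.two_le
  have := hjoin _ (isAP_filter_dvd_sub 1 (m + 1) (d := p) (by omega))
    (Finset.filter_subset _ _) (fun v hv => by
      rw [Finset.mem_union, Finset.mem_singleton] at hv
      rw [Finset.mem_filter]
      rcases hv with rfl | hv
      · exact ⟨Finset.mem_Icc.2 (by omega), by simpa using hqw⟩
      · exact ⟨hyt hv, hqr.trans ((hmem v (hyt hv)).1 hv)⟩)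
    (Finset.mem_Icc.2 (⟨by norm_num, by omega⟩ : (1 : ℤ) ≤ 2 ∧ 2 ≤ m + 1))
  have hp1 := Int.le_of_dvd (by norm_num) (Finset.mem_filter.1 this).2
  omega

theorem exists_interior_of_not_squarefree {m : ℤ} (hm : 1 ≤ m) (hsq : ¬ Squarefree m) :
    ∃ w : ℤ, 1 ≤ w ∧ w < m ∧ ∀ q : ℤ, Prime q → q ∣ m → q ∣ w := by
  simp only [Squarefree, not_forall] at hsq
  obtain ⟨s, ⟨t, ht⟩, hs⟩ := hsq
  have hst : 1 ≤ |s * t| := Int.one_le_abs fun h => by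
    rw [mul_assoc, h, mul_zero] at ht
    omega
  have hs2 : 2 ≤ |s| := by
    rw [Int.isUnit_iff] at hs
    have : s ≠ 0 := by rintro rfl; simp at ht; omega
    rcases abs_cases s with h | h <;> omega
  have hm_abs : m = |s| * |s * t| := by
    rw [← abs_mul, ← mul_assoc, ← ht, abs_of_pos (by omega)]
  refine ⟨|s * t|, hst, by nlinarith, fun q hq hqm => (dvd_abs _ _).2 ?_⟩
  rw [ht, mul_assoc] at hqm
  exact (hq.dvd_or_dvd hqm).elim (fun h => h.mul_right t) id

/-- For `n ≥ 2`, the lattice `L_n` is complemented if and only if `n-1` is squarefree;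
moreover if `n-1` is not squarefree, some `x ∉ {∅, [n]}` in `L_n` has `[n]` as its
only upper semicomplement. -/
theorem Ln_complemented_iff (n : ℕ) (hn : 2 ≤ n) :
    ((∀ x : Finset ℤ, IsAP x → x ⊆ Finset.Icc (1:ℤ) (n:ℤ) →
        ∃ y : Finset ℤ, IsAP y ∧ y ⊆ Finset.Icc (1:ℤ) (n:ℤ) ∧
          apJoin (Finset.Icc (1:ℤ) (n:ℤ)) x y = Finset.Icc (1:ℤ) (n:ℤ) ∧ x ∩ y = ∅) ↔
      Squarefree (n - 1)) ∧
    (¬ Squarefree (n - 1) →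
      ∃ x : Finset ℤ, IsAP x ∧ x ⊆ Finset.Icc (1:ℤ) (n:ℤ) ∧ x ≠ ∅ ∧
        x ≠ Finset.Icc (1:ℤ) (n:ℤ) ∧
        ∀ y : Finset ℤ, IsAP y → y ⊆ Finset.Icc (1:ℤ) (n:ℤ) →
          apJoin (Finset.Icc (1:ℤ) (n:ℤ)) x y = Finset.Icc (1:ℤ) (n:ℤ) →
          y = Finset.Icc (1:ℤ) (n:ℤ)) := by
  obtain ⟨m, rfl⟩ : ∃ m, n = m + 1 := ⟨n - 1, by omega⟩
  have hm : (1 : ℤ) ≤ m := by omega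
  simp only [Nat.add_sub_cancel, ← Int.squarefree_natCast]
  push_cast
  have hmoreover : ¬ Squarefree (m : ℤ) → ∃ w : ℤ, w ∈ Finset.Icc (1 : ℤ) (m + 1) ∧ w ≠ 1 ∧
      ∀ y : Finset ℤ, IsAP y → y ⊆ Finset.Icc (1 : ℤ) (m + 1) →
        apJoin (Finset.Icc (1 : ℤ) (m + 1)) {w} y = Finset.Icc (1 : ℤ) (m + 1) →
        y = Finset.Icc (1 : ℤ) (m + 1) := fun hsq => by
    obtain ⟨w, hw, hwm, hprime⟩ := exists_interior_of_not_squarefree hm hsq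
    exact ⟨w + 1, Finset.mem_Icc.2 (by omega), by omega, fun y hy hyt =>
      eq_top_of_apJoin_singleton_eq_top hw hwm hprime hy hyt⟩
  refine ⟨⟨fun hcompl => ?_, fun hsq x hx hxt => ?_⟩, fun hsq => ?_⟩
  · by_contra hsq
    obtain ⟨w, hwt, -, hw⟩ := hmoreover hsq
    obtain ⟨y, hy, hyt, hjoin, hmeet⟩ :=
      hcompl {w} (isAP_singleton w) (Finset.singleton_subset_iff.2 hwt)
    rw [hw y hy hyt hjoin, Finset.singleton_inter_of_mem hwt] at hmeet
    exact Finset.singleton_ne_empty w hmeet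
  · by_cases hend : (1 : ℤ) ∈ x ∨ (m : ℤ) + 1 ∈ x
    · exact exists_complement_of_endpoint_mem hm hx hxt hend
    · rw [not_or] at hend
      exact exists_complement_of_squarefree hm hsq hend.1 hend.2
  · obtain ⟨w, hwt, hw1, hw⟩ := hmoreover hsq
    refine ⟨{w}, isAP_singleton w, Finset.singleton_subset_iff.2 hwt,
      Finset.singleton_ne_empty w, fun h => hw1 ?_, hw⟩
    have h1 : (1 : ℤ) ∈ ({w} : Finset ℤ) := h ▸ Finset.mem_Icc.2 (by omega)
    exact (Finset.mem_singleton.1 h1).symm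
end
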